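/- Let α ∈ K^× be a 1-exceptional element. Then: (1) α is MSS-exceptional; (2) for any minimal norm pair ((a_0,…,a_{m-1}), d) of any length m ≥ 1, one has a_0 = i(K/F); (3) if i(K/F) ≠ -∞, then the cyclic F_p[G]-submodule of J_1 generated by (σ-1)[α]_1 = [σ(α)·α^{-1}]_1 is a free F_p[G_{i(K/F)}]-module. -/

import Mathlib

/-!
Common setup.  Throughout, `K/F` is a cyclic Galois extension of degree `p^n`
with Galois group `G = Gal(K/F)` generated by `σ`.  For `0 ≤ i ≤ n`, `K_i`
denotes the intermediate field of degree `p^i` over `F`, realized here via its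
unit group `KiU p σ i` (the units of `K` fixed by `σ^{p^i}`), and
`G_i = Gal(K_i/F)`.  For `m ≥ 1`, `R_m = ℤ/p^m` and `J_m = K^×/K^{×p^m}`.
-/

namespace MSS

variable {F K : Type*} [Field F] [Field K] [Algebra F K]

/-- Action of a field automorphism on the unit group. -/
def umap (σ : K ≃ₐ[F] K) : Kˣ →* Kˣ := Units.map (σ : K →* K)

/-- The norm from `K_j` to `F`, computed in `K` as the product of conjugates
`∏_{k < p^j} σ^k(γ)` (valid for `γ ∈ K_j`). -/
noncomputable def normHom (p : ℕ) (σ : K ≃ₐ[F] K) (j : ℕ) : Kˣ →* Kˣ :=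
  ∏ k ∈ Finset.range (p ^ j), umap (σ ^ k)

/-- The unit group of the intermediate field `K_i`: the units fixed by `σ^{p^i}`. -/
def KiU (p : ℕ) (σ : K ≃ₐ[F] K) (i : ℕ) : Subgroup Kˣ :=
  (umap (σ ^ p ^ i) / MonoidHom.id Kˣ).ker

/-- Membership in `K_a^×` for a level `a ∈ {-∞, 0, 1, …}`; level `-∞` means
the trivial group `{1}`. -/
def levelMem (p : ℕ) (σ : K ≃ₐ[F] K) (a : WithBot ℕ) (γ : Kˣ) : Prop :=
  WithBot.recBotCoe (γ = 1) (fun i => γ ∈ KiU p σ i) a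

/-- `(α, δ)` represents the pair `(a, d)`:  `σ(α)·α^{-d} = ∏_{i=0}^m δ_i^{p^i}` with
`δ_i ∈ K_{a_i}^×` for `i < m`, and
`ξ_p = N_{K/F}(α)^{(d-1)/p} · N_{K_{n-1}/F}(δ_0) · ∏_{i=1}^m N_{K/F}(δ_i)^{p^{i-1}}`. -/
noncomputable def Represents (p n : ℕ) (σ : K ≃ₐ[F] K) (ξ : Kˣ) {m : ℕ}
    (a : Fin m → WithBot ℕ) (d : ℤ) (α : Kˣ) (δ : ℕ → Kˣ) : Prop :=
  (∀ i : Fin m, levelMem p σ (a i) (δ i)) ∧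
  umap σ α = α ^ d * ∏ i ∈ Finset.range (m + 1), δ i ^ p ^ i ∧
  ξ = normHom p σ n α ^ ((d - 1) / (p : ℤ)) * normHom p σ (n - 1) (δ 0) *
      ∏ i ∈ Finset.Icc 1 m, normHom p σ n (δ i) ^ p ^ (i - 1)

/-- `(a, d)` is a norm pair of length `m`: `a ∈ {-∞,0,…,n}^m` with `a_0 < n`,
`d ∈ U_1`, and some `(α, δ)` represents `(a, d)`. -/
noncomputable def IsNormPair (p n : ℕ) (σ : K ≃ₐ[F] K) (ξ : Kˣ) {m : ℕ}
    (a : Fin m → WithBot ℕ) (d : ℤ) : Prop :=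
  (∀ i, a i ≤ (n : WithBot ℕ)) ∧
  (∀ h0 : 0 < m, a ⟨0, h0⟩ < (n : WithBot ℕ)) ∧
  (p : ℤ) ∣ d - 1 ∧
  ∃ (α : Kˣ) (δ : ℕ → Kˣ), Represents p n σ ξ a d α δ

/-- Strict lexicographic order on norm vectors (with `-∞` smallest). -/
def vecLT {m : ℕ} (a a' : Fin m → WithBot ℕ) : Prop :=
  ∃ k : Fin m, (∀ j : Fin m, j < k → a j = a' j) ∧ a k < a' k

/-- The order `d ≤_m d'` on twists: `d' ∈ U_i → d ∈ U_i` for `1 ≤ i ≤ m`, except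
when `p = 2` and `d, d' ∉ U_2`, in which case `d' ∈ -U_i → d ∈ -U_i` for `2 ≤ i ≤ m`. -/
def twistLE (p m : ℕ) (d d' : ℤ) : Prop :=
  ((p = 2 ∧ ¬ (4 : ℤ) ∣ (d - 1) ∧ ¬ (4 : ℤ) ∣ (d' - 1)) →
    ∀ i : ℕ, 2 ≤ i → i ≤ m → ((2 : ℤ) ^ i ∣ (d' + 1)) → ((2 : ℤ) ^ i ∣ (d + 1))) ∧
  (¬ (p = 2 ∧ ¬ (4 : ℤ) ∣ (d - 1) ∧ ¬ (4 : ℤ) ∣ (d' - 1)) →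
    ∀ i : ℕ, 1 ≤ i → i ≤ m → ((p : ℤ) ^ i ∣ (d' - 1)) → ((p : ℤ) ^ i ∣ (d - 1)))

/-- The order `⪯_m` on norm pairs of length `m`. -/
def pairLE (p : ℕ) {m : ℕ} (a : Fin m → WithBot ℕ) (d : ℤ)
    (a' : Fin m → WithBot ℕ) (d' : ℤ) : Prop :=
  vecLT a a' ∨ (a = a' ∧ twistLE p m d d')

/-- `(a, d)` is a minimal norm pair of length `m`. -/
noncomputable def IsMinimalNormPair (p n : ℕ) (σ : K ≃ₐ[F] K) (ξ : Kˣ) {m : ℕ}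
    (a : Fin m → WithBot ℕ) (d : ℤ) : Prop :=
  IsNormPair p n σ ξ a d ∧
  ∀ (a' : Fin m → WithBot ℕ) (d' : ℤ), IsNormPair p n σ ξ a' d' → pairLE p a d a' d'

/-- `α` is an `m`-exceptional element. -/
noncomputable def IsExceptional (p n : ℕ) (σ : K ≃ₐ[F] K) (ξ : Kˣ) (m : ℕ) (α : Kˣ) : Prop :=
  ∃ (a : Fin m → WithBot ℕ) (d : ℤ) (δ : ℕ → Kˣ),
    IsMinimalNormPair p n σ ξ a d ∧ Represents p n σ ξ a d α δ

/-- The subgroup of `q`-th powers in `K^×`. -/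
def powSub (K : Type*) [Field K] (q : ℕ) : Subgroup Kˣ := (powMonoidHom q : Kˣ →* Kˣ).range

/-- The class of a unit in `J_q := K^×/K^{×q}`. -/
def jcls (q : ℕ) (γ : Kˣ) : Kˣ ⧸ powSub K q := QuotientGroup.mk γ

/-- The action of a field automorphism on `J_q = K^×/K^{×q}`. -/
noncomputable def jmap (q : ℕ) (τ : K ≃ₐ[F] K) : (Kˣ ⧸ powSub K q) →* Kˣ ⧸ powSub K q :=
  QuotientGroup.map _ _ (umap τ) (by
    rintro x ⟨y, rfl⟩
    exact ⟨umap τ y, by simp [powMonoidHom, map_pow]⟩)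

/-- The natural map `J_q → J_{q'}` when `q' ∣ q`. -/
noncomputable def resMap (q q' : ℕ) (h : q' ∣ q) : (Kˣ ⧸ powSub K q) →* Kˣ ⧸ powSub K q' :=
  QuotientGroup.map _ _ (MonoidHom.id Kˣ) (by
    rintro x ⟨y, rfl⟩
    obtain ⟨c, rfl⟩ := h
    exact ⟨y ^ c, by simp [powMonoidHom, ← pow_mul, mul_comm]⟩)

/-- The `R_m[G]`-submodule of `J_q` generated by the classes of the elements of `S`:
the subgroup generated by all `σ^k`-conjugates of classes of elements of `S`. -/
noncomputable def galSpan (q : ℕ) (σ : K ≃ₐ[F] K) (S : Set Kˣ) : Subgroup (Kˣ ⧸ powSub K q) :=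
  Subgroup.closure {x | ∃ γ ∈ S, ∃ k : ℕ, x = jcls q (umap (σ ^ k) γ)}

/-- The subgroup `(σ-1)J_q` of `J_q`. -/
noncomputable def augSub (q : ℕ) (σ : K ≃ₐ[F] K) : Subgroup (Kˣ ⧸ powSub K q) :=
  Subgroup.closure {x | ∃ y : Kˣ ⧸ powSub K q, x = jmap q σ y * y⁻¹}

/-- The cyclic `F_p[G]`-submodule of `J_1 = K^×/K^{×p}` generated by `[γ]_1` is a
free `F_p[G_i]`-module (on the generator `[γ]_1`): `[γ]_1` is fixed by `σ^{p^i}`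
and the conjugates `σ^k [γ]_1`, `k < p^i`, are `F_p`-linearly independent. -/
noncomputable def FreeCyc (p : ℕ) (σ : K ≃ₐ[F] K) (i : ℕ) (γ : Kˣ) : Prop :=
  jcls p (umap (σ ^ p ^ i) γ) = jcls p γ ∧
  ∀ c : Fin (p ^ i) → ZMod p,
    (∏ k : Fin (p ^ i), jcls p (umap (σ ^ (k : ℕ)) γ) ^ (c k).val) = 1 → c = 0

/-- An (indexed) internal direct sum decomposition of a commutative group. -/
def IsDirectSumDecomp {G : Type*} [CommGroup G] {ι : Sort*} (f : ι → Subgroup G) : Prop :=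
  iSupIndep f ∧ (⨆ i, f i) = ⊤

/-- The subgroup `F^×` of `K^×` (units coming from the base field). -/
def Funits (F : Type*) {K : Type*} [Field F] [Field K] [Algebra F K] : Subgroup Kˣ :=
  (Units.map (algebraMap F K : F →* K)).range

/-- The subgroup `F^{×p}` of `K^×`. -/
def FpPow (F : Type*) {K : Type*} [Field F] [Field K] [Algebra F K] (p : ℕ) : Subgroup Kˣ :=
  (Funits F).map (powMonoidHom p)

/-- The subgroup `N_{K_i/F}(K_i^×)` of `K^×`. -/
noncomputable def NormSub (p : ℕ) (σ : K ≃ₐ[F] K) (i : ℕ) : Subgroup Kˣ :=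
  (KiU p σ i).map (normHom p σ i)

/-- The subgroup `N_{K_i/F}(K_i^×)·F^{×p}` of `K^×`. -/
noncomputable def NiF (p : ℕ) (σ : K ≃ₐ[F] K) (i : ℕ) : Subgroup Kˣ :=
  NormSub p σ i ⊔ FpPow F p

/-- The `F_p`-dimension of an (elementary abelian `p`-) commutative group `Q`,
computed as the rank of `F_p ⊗_ℤ Q`. -/
noncomputable def fpdim (p : ℕ) (Q : Type*) [CommGroup Q] : Cardinal :=
  Module.rank (ZMod p) (TensorProduct ℤ (ZMod p) (Additive Q))

/-- The invariant `e_i(K/F)`: for `i < n` the `F_p`-dimension of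
`N_{K_i/F}(K_i^×)F^{×p} / N_{K_{i+1}/F}(K_{i+1}^×)F^{×p}`, and for `i = n` the
`F_p`-dimension of `N_{K/F}(K^×)F^{×p}/F^{×p}`. -/
noncomputable def eKF (p n : ℕ) (σ : K ≃ₐ[F] K) (i : ℕ) : Cardinal :=
  if i < n then
    fpdim p ((NiF p σ i) ⧸ (NiF p σ (i + 1)).subgroupOf (NiF p σ i))
  else
    fpdim p ((NiF p σ n) ⧸ (FpPow F p).subgroupOf (NiF p σ n))

/-- The group ring `R_m[G_i] = (ℤ/p^m)[ℤ/p^i]` (for the cyclic group `G_i` of order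
`p^i`). -/
abbrev CycGR (p m i : ℕ) : Type :=
  MonoidAlgebra (ZMod (p ^ m)) (Multiplicative (ZMod (p ^ i)))

/-- The image of the generator `σ` of `G_i` in the group ring `R_m[G_i]`. -/
noncomputable def gen (p m i : ℕ) : CycGR p m i :=
  MonoidAlgebra.of _ _ (Multiplicative.ofAdd (1 : ZMod (p ^ i)))

/-- Standard basis vector of the free `R_m[G]`-module on generators `e_0, …, e_m`. -/
noncomputable def sing (p n m : ℕ) (j : Fin (m + 1)) (c : CycGR p m n) :
    Fin (m + 1) → CycGR p m n :=
  Pi.single j c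

/-- The relations defining the module `X_{a,d,m}`: on generators `y = e_0` and
`x_i = e_{i+1}` (`0 ≤ i < m`), we impose `(σ - d)·y = Σ_i p^i x_i`, and
`(σ^{p^{a_i}} - 1)·x_i = 0` when `a_i ≠ -∞`, resp. `x_i = 0` when `a_i = -∞`. -/
noncomputable def XRels (p n m : ℕ) (a : Fin m → WithBot ℕ) (d : ℤ) :
    Set (Fin (m + 1) → CycGR p m n) :=
  insert
    (sing p n m 0 (gen p m n - (d : ZMod (p ^ m)) • 1) -
      ∑ i : Fin m, sing p n m i.succ ((p : CycGR p m n) ^ (i : ℕ)))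
    {r | ∃ i : Fin m, r = sing p n m i.succ
      (WithBot.recBotCoe (1 : CycGR p m n) (fun k => gen p m n ^ p ^ k - 1) (a i))}

/-- The `R_m[G]`-module `X_{a,d,m}`. -/
noncomputable abbrev Xadm (p n m : ℕ) (a : Fin m → WithBot ℕ) (d : ℤ) :=
  (Fin (m + 1) → CycGR p m n) ⧸ Submodule.span (CycGR p m n) (XRels p n m a d)

/-- Indecomposability of a module. -/
def IsIndecomposable (R M : Type*) [Ring R] [AddCommGroup M] [Module R M] : Prop :=
  (⊤ : Submodule R M) ≠ ⊥ ∧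
  ∀ S T : Submodule R M, S ⊓ T = ⊥ → S ⊔ T = ⊤ → S = ⊥ ∨ T = ⊥

end MSS

namespace MSS

variable {F K : Type*} [Field F] [Field K] [Algebra F K]

/-- The subgroup `K_a^×` of `K^×` for a level `a ∈ {-∞, 0, …}` (`K_{-∞}^× = {1}`). -/
def levelSub (p : ℕ) (σ : K ≃ₐ[F] K) (a : WithBot ℕ) : Subgroup Kˣ :=
  WithBot.recBotCoe ⊥ (fun i => KiU p σ i) a

/-- The condition appearing in the definition of `i(K/F)`: there is `γ ∈ K^×`
with `N_{K/F}(γ) ∉ F^{×p}` and `(τ-1)[γ]_1 ∈ [K_j^×]_1` for all `τ ∈ Gal(K/F)`. -/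
noncomputable def iKFCond (p n : ℕ) (σ : K ≃ₐ[F] K) (j : WithBot ℕ) : Prop :=
  j ≤ (n : WithBot ℕ) ∧ ∃ γ : Kˣ,
    normHom p σ n γ ∉ FpPow F p ∧
    ∀ τ : K ≃ₐ[F] K, jcls p (umap τ γ * γ⁻¹) ∈
      (levelSub p σ j).map (QuotientGroup.mk' (powSub K p))

/-- The invariant `i(K/F)`. -/
noncomputable def iKF (F : Type*) {K : Type*} [Field F] [Field K] [Algebra F K]
    (p n : ℕ) (σ : K ≃ₐ[F] K) : WithBot ℕ :=
  sInf {j : WithBot ℕ | iKFCond p n σ j}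

/-- `γ` is MSS-exceptional: it realizes the minimum in the definition of `i(K/F)`. -/
noncomputable def IsMSSExceptional (p n : ℕ) (σ : K ≃ₐ[F] K) (γ : Kˣ) : Prop :=
  normHom p σ n γ ∉ FpPow F p ∧
  ∀ τ : K ≃ₐ[F] K, jcls p (umap τ γ * γ⁻¹) ∈
    (levelSub p σ (iKF F p n σ)).map (QuotientGroup.mk' (powSub K p))

end MSS

universe u v

namespace MSS

section PartialNorm

variable {A : Type*} [CommGroup A]

/-- The partial norm `x ↦ ∏_{k < m} s^k(x)` attached to an endomorphism `s`. -/
def partialNorm (s : A →* A) (m : ℕ) : A →* A where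
  toFun x := ∏ k ∈ Finset.range m, s^[k] x
  map_one' := by simp [iterate_map_one]
  map_mul' x y := by simp [iterate_map_mul, Finset.prod_mul_distrib]

/-- The product `x ↦ ∏_{k < m} N_k(x)` of the partial norms `N_k`. -/
def partialNormProd (s : A →* A) (m : ℕ) : A →* A where
  toFun x := ∏ k ∈ Finset.range m, partialNorm s k x
  map_one' := by simp
  map_mul' x y := by simp [Finset.prod_mul_distrib]

variable (s : A →* A)

lemma partialNorm_apply (m : ℕ) (x : A) :
    partialNorm s m x = ∏ k ∈ Finset.range m, s^[k] x := rfl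

@[simp] lemma partialNorm_zero (x : A) : partialNorm s 0 x = 1 := by simp [partialNorm_apply]

lemma partialNorm_succ (m : ℕ) (x : A) :
    partialNorm s (m + 1) x = partialNorm s m x * s^[m] x := by
  simp [partialNorm_apply, Finset.prod_range_succ]

@[simp] lemma partialNormProd_zero (x : A) : partialNormProd s 0 x = 1 := by
  simp [partialNormProd]

lemma partialNormProd_succ (m : ℕ) (x : A) :
    partialNormProd s (m + 1) x = partialNormProd s m x * partialNorm s m x := by
  simp [partialNormProd, Finset.prod_range_succ]

lemma map_partialNorm_mul (m : ℕ) (x : A) :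
    s (partialNorm s m x) * x = partialNorm s m x * s^[m] x := by
  rw [← partialNorm_succ, partialNorm_apply, partialNorm_apply, Finset.prod_range_succ', map_prod]
  simp [Function.iterate_succ_apply']

lemma pow_mul_map_partialNormProd (m : ℕ) (x : A) :
    x ^ m * s (partialNormProd s m x) = partialNormProd s m x * partialNorm s m x := by
  induction m with
  | zero => simp
  | succ m ih =>
    have h := map_partialNorm_mul s m x
    rw [partialNormProd_succ, map_mul, partialNorm_succ, ← h, pow_succ]
    calc _ = (x ^ m * s (partialNormProd s m x)) * (s (partialNorm s m x) * x) := by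
          simp only [mul_comm, mul_assoc, mul_left_comm]
      _ = _ := by rw [ih]

variable {s}

lemma partialNorm_of_fixed {x : A} (h : s x = x) (m : ℕ) : partialNorm s m x = x ^ m := by
  simp [partialNorm_apply, Function.iterate_fixed h]

lemma map_partialNorm {m : ℕ} {x : A} (h : s^[m] x = x) :
    s (partialNorm s m x) = partialNorm s m x := by
  have := map_partialNorm_mul s m x
  rw [h] at this
  exact mul_right_cancel this

lemma iterate_partialNorm {M : ℕ} {x : A} (h : s^[M] x = x) (m : ℕ) :
    s^[M] (partialNorm s m x) = partialNorm s m x := by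
  induction m with
  | zero => simp [iterate_map_one]
  | succ m ih =>
    rw [partialNorm_succ, iterate_map_mul, ih, ← Function.iterate_add_apply, add_comm,
      Function.iterate_add_apply, h]

lemma partialNorm_add (a b : ℕ) (x : A) :
    partialNorm s (a + b) x = partialNorm s a x * s^[a] (partialNorm s b x) := by
  induction b with
  | zero => simp [iterate_map_one]
  | succ b ih =>
    rw [← add_assoc, partialNorm_succ, partialNorm_succ, ih, iterate_map_mul,
      ← Function.iterate_add_apply, mul_assoc]

lemma iterate_mul_of_iterate {t : A →* A} {a : ℕ} (ht : ∀ x, t x = s^[a] x) (b : ℕ) (x : A) :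
    s^[a * b] x = t^[b] x := by
  rw [Function.iterate_mul, show (⇑t) = s^[a] from funext ht]

lemma partialNorm_mul {t : A →* A} {a : ℕ} (ht : ∀ x, t x = s^[a] x) (b : ℕ) (x : A) :
    partialNorm s (a * b) x = partialNorm t b (partialNorm s a x) := by
  induction b with
  | zero => simp
  | succ b ih =>
    rw [Nat.mul_succ, partialNorm_add, ih, partialNorm_succ, iterate_mul_of_iterate ht]

lemma iterate_of_map_eq_mul {α y : A} (h : s α = α * y) (m : ℕ) :
    s^[m] α = α * partialNorm s m y := by
  induction m with
  | zero => simp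
  | succ m ih =>
    have e := map_partialNorm_mul s m y
    rw [Function.iterate_succ_apply', ih, map_mul, h, partialNorm_succ, ← e, mul_assoc,
      mul_comm y]

lemma partialNorm_of_map_eq_mul {α y : A} (h : s α = α * y) (m : ℕ) :
    partialNorm s m α = α ^ m * partialNormProd s m y := by
  induction m with
  | zero => simp
  | succ m ih =>
    rw [partialNorm_succ, ih, iterate_of_map_eq_mul h, partialNormProd_succ, pow_succ]
    simp only [mul_comm, mul_assoc, mul_left_comm]

lemma partialNorm_mul_of_iterate_fixed {M : ℕ} {x : A} (h : s^[M] x = x) (q : ℕ) :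
    partialNorm s (M * q) x = partialNorm s M x ^ q := by
  induction q with
  | zero => simp
  | succ q ih =>
    rw [mul_add, mul_one, add_comm, partialNorm_add, iterate_partialNorm h, ih, pow_succ']

lemma partialNormProd_add_of_iterate_fixed {M : ℕ} {x : A} (h : s^[M] x = x) (q r : ℕ) :
    partialNormProd s (M * q + r) x =
      partialNormProd s (M * q) x * (partialNorm s M x ^ (q * r) * partialNormProd s r x) := by
  induction r with
  | zero => simp
  | succ r ih =>
    have h' : s^[M * q] (partialNorm s r x) = partialNorm s r x := by
      rw [Function.iterate_mul]
      exact Function.iterate_fixed (iterate_partialNorm h r) q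
    rw [← add_assoc, partialNormProd_succ, ih, partialNorm_add, h', partialNormProd_succ,
      partialNorm_mul_of_iterate_fixed h, mul_add, mul_one, pow_add]
    simp only [mul_comm, mul_assoc, mul_left_comm]

lemma partialNormProd_mul_of_iterate_fixed {M : ℕ} {x : A} (h : s^[M] x = x) (q : ℕ) :
    partialNormProd s (M * q) x =
      partialNorm s M x ^ (M * ∑ i ∈ Finset.range q, i) * partialNormProd s M x ^ q := by
  induction q with
  | zero => simp
  | succ q ih =>
    rw [mul_add, mul_one, partialNormProd_add_of_iterate_fixed h, ih, Finset.sum_range_succ,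
      mul_add, pow_add, pow_succ (partialNormProd s M x), mul_comm M q]
    simp only [mul_comm, mul_assoc, mul_left_comm]

lemma exists_partialNormProd_eq_pow {M p : ℕ} (hM : Even (M * (p - 1))) {x : A}
    (h : s^[M] x = x) :
    ∃ P : A, partialNormProd s (M * p) x = P ^ p ∧ x ^ M * s P = P * partialNorm s M x := by
  obtain ⟨c, hc⟩ := hM
  refine ⟨partialNorm s M x ^ c * partialNormProd s M x, ?_, ?_⟩
  · have e : M * ∑ i ∈ Finset.range p, i = c * p := by
      have h2 := Finset.sum_range_id_mul_two p
      have : (M * ∑ i ∈ Finset.range p, i) * 2 = c * p * 2 := by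
        rw [mul_assoc, h2, mul_left_comm, hc]; ring
      exact Nat.eq_of_mul_eq_mul_right two_pos this
    rw [partialNormProd_mul_of_iterate_fixed h, e, mul_pow, pow_mul]
  · have e := pow_mul_map_partialNormProd s M x
    rw [map_mul, map_pow, map_partialNorm h, mul_left_comm, e, mul_assoc]

/-- A `p`-th root of the norm of `α`, together with the defect of its invariance. -/
lemma exists_norm_eq_pow {M p : ℕ} {α x w : A}
    (h : s α = α * (x * w ^ p))
    (hx : ∃ P : A, partialNormProd s (M * p) x = P ^ p ∧ x ^ M * s P = P * partialNorm s M x) :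
    ∃ E : A, partialNorm s (M * p) α = E ^ p ∧
      s E = E * (partialNorm s M x * partialNorm s (M * p) w) := by
  obtain ⟨P, hP, hP'⟩ := hx
  refine ⟨α ^ M * P * partialNormProd s (M * p) w, ?_, ?_⟩
  · rw [partialNorm_of_map_eq_mul h, map_mul, map_pow, hP, mul_pow, mul_pow, pow_mul, mul_assoc]
  · have e := pow_mul_map_partialNormProd s (M * p) w
    calc _ = α ^ M * (x ^ M * s P) * (w ^ (M * p) * s (partialNormProd s (M * p) w)) := by
          simp only [map_mul, map_pow, h, mul_pow, ← pow_mul, mul_comm p M]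
          simp only [mul_comm, mul_assoc, mul_left_comm]
      _ = _ := by
          rw [hP', e]
          simp only [mul_comm, mul_assoc, mul_left_comm]

end PartialNorm

section TruncatedPolynomial

open Polynomial

/-- If `v` is killed by a nonzero polynomial in `f` of degree `< q = p ^ k`, and by `f ^ q - 1`,
then it is killed by `∑_{l < q} f ^ l`. -/
lemma sum_pow_apply_eq_zero {p : ℕ} [Fact p.Prime] {V : Type*} [AddCommGroup V]
    [Module (ZMod p) V] (f : Module.End (ZMod p) V) {q k : ℕ} (hq : q = p ^ k)
    (v : V) (hv : (f ^ q) v = v) (c : Fin q → ZMod p) (hc : c ≠ 0)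
    (h : ∑ l, c l • (f ^ (l : ℕ)) v = 0) :
    ∑ l ∈ Finset.range q, (f ^ l) v = 0 := by
  have hq0 : 0 < q := hq ▸ pow_pos (Fact.out : p.Prime).pos k
  set P : (ZMod p)[X] := ∑ l : Fin q, C (c l) * X ^ (l : ℕ) with hP
  have hdeg : P.degree < q := degree_sum_fin_lt c
  have hP0 : P ≠ 0 := by
    intro h0
    apply hc
    funext i
    have := congrArg (fun Q => Q.coeff (i : ℕ)) h0
    simpa [hP, finsetSum_coeff, coeff_C_mul, coeff_X_pow, Fin.val_inj] using this
  have hPv : (aeval f P) v = 0 := by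
    rw [← h]
    simp [hP, map_sum, LinearMap.sum_apply, Algebra.algebraMap_eq_smul_one]
  have hXq : (X - C 1 : (ZMod p)[X]) ^ q = X ^ q - 1 := by
    simpa [hq] using sub_pow_expChar_pow (X : (ZMod p)[X]) 1 k (p := p)
  have hXv : (aeval f ((X - C 1 : (ZMod p)[X]) ^ q)) v = 0 := by
    rw [hXq]
    simp [hv]
  obtain ⟨Q, hQ, hQ'⟩ := exists_eq_pow_rootMultiplicity_mul_and_not_dvd P hP0 1
  set r := rootMultiplicity 1 P with hr
  have hrq : r < q := by
    have h1 : r ≤ P.natDegree := by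
      rw [hr, ← count_roots]
      exact (Multiset.count_le_card _ _).trans (card_roots' P)
    exact h1.trans_lt ((natDegree_lt_iff_degree_lt hP0).2 hdeg)
  have hcop : IsCoprime ((X - C 1 : (ZMod p)[X]) ^ q) Q :=
    (((irreducible_X_sub_C (1 : ZMod p)).coprime_iff_not_dvd).2 hQ').pow_left
  obtain ⟨a, b, hab⟩ := hcop
  have hgeom : (∑ l ∈ Finset.range q, X ^ l : (ZMod p)[X]) = (X - C 1) ^ (q - 1) := by
    apply mul_right_cancel₀ (X_sub_C_ne_zero (1 : ZMod p))
    rw [← pow_succ, Nat.sub_add_cancel hq0, hXq, C_1, geom_sum_mul]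
  have key : (X - C 1 : (ZMod p)[X]) ^ (q - 1) =
      ((X - C 1) ^ (q - 1 - r) * b) * P + ((X - C 1) ^ (q - 1) * a) * (X - C 1) ^ q := by
    have e : (X - C 1 : (ZMod p)[X]) ^ (q - 1) = (X - C 1) ^ (q - 1 - r) * (X - C 1) ^ r := by
      rw [← pow_add]; congr 1; omega
    calc (X - C 1 : (ZMod p)[X]) ^ (q - 1)
        = (X - C 1) ^ (q - 1) * (a * (X - C 1) ^ q + b * Q) := by rw [hab, mul_one]
      _ = (X - C 1) ^ (q - 1) * a * (X - C 1) ^ q + (X - C 1) ^ (q - 1) * b * Q := by ring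
      _ = _ := by
        nth_rewrite 2 [e]
        rw [hQ]; ring
  have : (aeval f (∑ l ∈ Finset.range q, X ^ l : (ZMod p)[X])) v = 0 := by
    rw [hgeom, key, map_add, map_mul, map_mul _ _ ((X - C 1) ^ q), LinearMap.add_apply,
      Module.End.mul_apply, Module.End.mul_apply, hPv, hXv, map_zero, map_zero, add_zero]
  simpa [map_sum, LinearMap.sum_apply] using this

/-- In a commutative group of exponent `p`, a nontrivial multiplicative relation between the
first `q = p ^ k` iterates of an element of period `q` forces its partial norm to be trivial. -/
lemma partialNorm_eq_one_of_prod_pow_eq_one {p : ℕ} [Fact p.Prime] {A : Type*} [CommGroup A]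
    (hA : ∀ a : A, a ^ p = 1) (s : A →* A) {q k : ℕ} (hq : q = p ^ k) (v : A)
    (hv : s^[q] v = v) (c : Fin q → ZMod p) (hc : c ≠ 0)
    (h : ∏ l : Fin q, s^[l] v ^ (c l).val = 1) : partialNorm s q v = 1 := by
  obtain ⟨_⟩ : Nonempty (Module (ZMod p) (Additive A)) :=
    ⟨AddCommGroup.zmodModule fun a => congrArg Additive.ofMul (hA a.toMul)⟩
  let f : Module.End (ZMod p) (Additive A) := (MonoidHom.toAdditive s).toZModLinearMap p
  have hf (l : ℕ) : (f ^ l) (Additive.ofMul v) = Additive.ofMul (s^[l] v) := by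
    induction l with
    | zero => rfl
    | succ l ih => rw [pow_succ', Module.End.mul_apply, ih, Function.iterate_succ_apply']; rfl
  have key := sum_pow_apply_eq_zero f hq (Additive.ofMul v) (by rw [hf, hv]) c hc (by
    rw [← ofMul_one, ← h, ofMul_prod]
    refine Finset.sum_congr rfl fun l _ => ?_
    rw [hf, ofMul_pow, ← Nat.cast_smul_eq_nsmul (ZMod p), ZMod.natCast_zmod_val])
  simp only [hf] at key
  rwa [← ofMul_prod, ofMul_eq_zero] at key

end TruncatedPolynomial

section GaloisAction

variable {F K : Type*} [Field F] [Field K] [Algebra F K]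

@[simp] lemma coe_umap (σ : K ≃ₐ[F] K) (x : Kˣ) : (umap σ x : K) = σ x := rfl

lemma umap_mul_apply (σ τ : K ≃ₐ[F] K) (x : Kˣ) : umap (σ * τ) x = umap σ (umap τ x) := rfl

lemma umap_pow_apply (σ : K ≃ₐ[F] K) (k : ℕ) (x : Kˣ) : umap (σ ^ k) x = (umap σ)^[k] x := by
  induction k with
  | zero => ext; simp
  | succ k ih => rw [pow_succ', umap_mul_apply, ih, Function.iterate_succ_apply']

lemma normHom_eq (p : ℕ) (σ : K ≃ₐ[F] K) (j : ℕ) (x : Kˣ) :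
    normHom p σ j x = partialNorm (umap σ) (p ^ j) x := by
  simp [normHom, partialNorm_apply, MonoidHom.finsetProd_apply, umap_pow_apply]

lemma mem_KiU {p : ℕ} {σ : K ≃ₐ[F] K} {i : ℕ} {x : Kˣ} :
    x ∈ KiU p σ i ↔ (umap σ)^[p ^ i] x = x := by
  rw [← umap_pow_apply, KiU, MonoidHom.mem_ker, MonoidHom.div_apply, div_eq_one]
  rfl

lemma levelMem_iff {p : ℕ} {σ : K ≃ₐ[F] K} {a : WithBot ℕ} {x : Kˣ} :
    levelMem p σ a x ↔ x ∈ levelSub p σ a := by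
  induction a using WithBot.recBotCoe with
  | bot => exact Subgroup.mem_bot.symm
  | coe i => exact Iff.rfl

lemma mem_levelSub_bot {p : ℕ} {σ : K ≃ₐ[F] K} {x : Kˣ} : x ∈ levelSub p σ ⊥ ↔ x = 1 :=
  Subgroup.mem_bot

lemma mem_levelSub_coe {p : ℕ} {σ : K ≃ₐ[F] K} {i : ℕ} {x : Kˣ} :
    x ∈ levelSub p σ (i : WithBot ℕ) ↔ (umap σ)^[p ^ i] x = x :=
  mem_KiU

lemma iterate_eq_of_mem_levelSub {p : ℕ} {σ : K ≃ₐ[F] K} {a : WithBot ℕ} {j : ℕ} {x : Kˣ}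
    (hx : x ∈ levelSub p σ a) (ha : a ≤ (j : WithBot ℕ)) : (umap σ)^[p ^ j] x = x := by
  induction a using WithBot.recBotCoe with
  | bot => rw [mem_levelSub_bot.1 hx, iterate_map_one]
  | coe i =>
    obtain ⟨c, rfl⟩ := Nat.exists_eq_add_of_le (WithBot.coe_le_coe.1 ha)
    rw [pow_add, Function.iterate_mul]
    exact Function.iterate_fixed (mem_levelSub_coe.1 hx) _

lemma partialNorm_mem_levelSub {p : ℕ} {σ : K ≃ₐ[F] K} {a : WithBot ℕ} {x : Kˣ}
    (hx : x ∈ levelSub p σ a) (k : ℕ) : partialNorm (umap σ) k x ∈ levelSub p σ a := by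
  induction a using WithBot.recBotCoe with
  | bot => rw [mem_levelSub_bot] at hx ⊢; rw [hx, map_one]
  | coe i => exact mem_levelSub_coe.2 (iterate_partialNorm (mem_levelSub_coe.1 hx) k)

lemma jcls_mem_map_iff {p : ℕ} {H : Subgroup Kˣ} {x : Kˣ} :
    jcls p x ∈ H.map (QuotientGroup.mk' (powSub K p)) ↔ ∃ δ ∈ H, ∃ w : Kˣ, x = δ * w ^ p := by
  constructor
  · rintro ⟨δ, hδ, h⟩
    obtain ⟨z, ⟨w, rfl⟩, hz⟩ := (QuotientGroup.mk'_eq_mk' _).1 h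
    exact ⟨δ, hδ, w, hz.symm⟩
  · rintro ⟨δ, hδ, w, rfl⟩
    exact ⟨δ, hδ, (QuotientGroup.mk'_eq_mk' _).2 ⟨w ^ p, ⟨w, rfl⟩, rfl⟩⟩

/-- Hilbert's Theorem 90 for a cyclic group of automorphisms. -/
lemma exists_map_eq_mul_of_partialNorm_eq_one (τ : K ≃ₐ[F] K) (hτ : 0 < orderOf τ) {y : Kˣ}
    (h : partialNorm (umap τ) (orderOf τ) y = 1) : ∃ u : Kˣ, umap τ u = u * y := by
  set r := orderOf τ with hr
  let χ : Fin r → K →* K := fun l => ((τ ^ (l : ℕ) : K ≃ₐ[F] K) : K →* K)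
  have hχ : Function.Injective χ := by
    intro i j hij
    apply Fin.ext
    apply pow_injOn_Iio_orderOf (x := τ) i.2 j.2
    ext z
    exact DFunLike.congr_fun hij z
  have hli := (linearIndependent_monoidHom K K).comp χ hχ
  let c : ℕ → K := fun l => ((partialNorm (umap τ) l y : Kˣ) : K)
  obtain ⟨z, hz⟩ : ∃ z : K, ∑ l ∈ Finset.range r, c l * (τ ^ l) z ≠ 0 := by
    by_contra! hcon
    have h0 := Fintype.linearIndependent_iff.1 hli (fun l => c l) (by
      funext z
      refine Eq.trans ?_ (hcon z)
      rw [← Fin.sum_univ_eq_sum_range (fun l => c l * (τ ^ l) z)]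
      simp [χ]) ⟨0, hτ⟩
    simp [c] at h0
  have hstep (l : ℕ) : (y : K) * τ (c l * (τ ^ l) z) = c (l + 1) * (τ ^ (l + 1)) z := by
    have e := congrArg (fun t : Kˣ => (t : K)) (map_partialNorm_mul (umap τ) l y)
    rw [← partialNorm_succ] at e
    simp only [Units.val_mul, coe_umap] at e
    rw [map_mul, pow_succ', AlgEquiv.mul_apply, ← mul_assoc, mul_comm (y : K), e]
  have key : (y : K) * τ (∑ l ∈ Finset.range r, c l * (τ ^ l) z) =
      ∑ l ∈ Finset.range r, c l * (τ ^ l) z := by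
    rw [map_sum, Finset.mul_sum, Finset.sum_congr rfl fun l _ => hstep l]
    have e := (Finset.sum_range_succ' (fun l => c l * (τ ^ l) z) r).symm.trans
      (Finset.sum_range_succ (fun l => c l * (τ ^ l) z) r)
    have e0 : c r * (τ ^ r) z = c 0 * (τ ^ 0) z := by
      simp only [c, h]
      simp [hr, pow_orderOf_eq_one]
    rw [e0] at e
    exact add_right_cancel e
  refine ⟨(Units.mk0 _ hz)⁻¹, ?_⟩
  rw [map_inv, inv_eq_iff_eq_inv, mul_inv, inv_inv, ← div_eq_mul_inv, eq_div_iff_mul_eq'']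
  exact Units.ext key

variable {p n : ℕ} {σ : K ≃ₐ[F] K}

lemma orderOf_pow_prime_pow (hp : p.Prime) (horder : orderOf σ = p ^ n) {k : ℕ} (hk : k ≤ n) :
    orderOf (σ ^ p ^ k) = p ^ (n - k) := by
  rw [orderOf_pow_of_dvd (pow_pos hp.pos k).ne' (horder ▸ pow_dvd_pow p hk), horder,
    Nat.pow_div hk hp.pos]

lemma exists_map_pow_eq_mul (hp : p.Prime) (horder : orderOf σ = p ^ n) {k : ℕ} (hk : k ≤ n)
    {y : Kˣ} (h : partialNorm (umap (σ ^ p ^ k)) (p ^ (n - k)) y = 1) :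
    ∃ u : Kˣ, (umap σ)^[p ^ k] u = u * y := by
  have e := orderOf_pow_prime_pow hp horder hk
  obtain ⟨u, hu⟩ := exists_map_eq_mul_of_partialNorm_eq_one (σ ^ p ^ k)
    (e ▸ pow_pos hp.pos _) (by rw [e]; exact h)
  exact ⟨u, by rw [← umap_pow_apply, hu]⟩

lemma umap_iterate_eq (horder : orderOf σ = p ^ n) (x : Kˣ) : (umap σ)^[p ^ n] x = x := by
  rw [← umap_pow_apply, ← horder, pow_orderOf_eq_one]
  ext; simp

lemma umap_eq_of_mem_Funits {x : Kˣ} (hx : x ∈ Funits F) : umap σ x = x := by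
  obtain ⟨y, rfl⟩ := hx
  ext; simp

lemma umap_root_of_unity (hp : p.Prime) {ξ : Kˣ} (hξ : IsPrimitiveRoot (ξ : K) p)
    (hξF : ξ ∈ Funits F) {ζ : Kˣ} (hζ : ζ ^ p = 1) : umap σ ζ = ζ := by
  have : NeZero p := ⟨hp.ne_zero⟩
  obtain ⟨i, -, hi⟩ := hξ.eq_pow_of_pow_eq_one (ξ := (ζ : K)) (by
    rw [← Units.val_pow_eq_pow_val, hζ, Units.val_one])
  have : ζ = ξ ^ i := Units.ext (by rw [← hi, Units.val_pow_eq_pow_val])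
  rw [this, map_pow, umap_eq_of_mem_Funits hξF]

lemma jcls_mem_of_map_eq [FiniteDimensional F K]
    (hgen : ∀ τ : K ≃ₐ[F] K, τ ∈ Subgroup.zpowers σ) {a : WithBot ℕ}
    {γ x w : Kˣ} (hx : x ∈ levelSub p σ a) (h : umap σ γ = γ * (x * w ^ p)) (τ : K ≃ₐ[F] K) :
    jcls p (umap τ γ * γ⁻¹) ∈ (levelSub p σ a).map (QuotientGroup.mk' (powSub K p)) := by
  obtain ⟨k, rfl⟩ := mem_powers_iff_mem_zpowers.2 (hgen τ)
  rw [jcls_mem_map_iff]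
  refine ⟨partialNorm (umap σ) k x, partialNorm_mem_levelSub hx k, partialNorm (umap σ) k w, ?_⟩
  rw [umap_pow_apply, iterate_of_map_eq_mul h, map_mul, map_pow, mul_inv_cancel_comm]

lemma iKFCond_iff [FiniteDimensional F K]
    (hgen : ∀ τ : K ≃ₐ[F] K, τ ∈ Subgroup.zpowers σ) {j : WithBot ℕ} :
    iKFCond p n σ j ↔ j ≤ (n : WithBot ℕ) ∧ ∃ γ x w : Kˣ,
      partialNorm (umap σ) (p ^ n) γ ∉ FpPow F p ∧ x ∈ levelSub p σ j ∧
        umap σ γ = γ * (x * w ^ p) := by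
  constructor
  · rintro ⟨hj, γ, hγ, h⟩
    obtain ⟨x, hx, w, hw⟩ := jcls_mem_map_iff.1 (h σ)
    exact ⟨hj, γ, x, w, normHom_eq p σ n γ ▸ hγ, hx, by rw [← hw, mul_comm, inv_mul_cancel_right]⟩
  · rintro ⟨hj, γ, x, w, hγ, hx, h⟩
    exact ⟨hj, γ, by rwa [normHom_eq], jcls_mem_of_map_eq hgen hx h⟩

/-- If `N_{K_k/F}(x)` is a `p`-th power of an element of `F`, then `x` may be moved to
`K_{k-1}` by an element of `(σ - 1)K_k^×`. -/
lemma exists_mul_div_mem_of_norm_eq_pow (hp : p.Prime) (horder : orderOf σ = p ^ n) {k : ℕ}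
    (hk : k < n) {x z : Kˣ} (hz : umap σ z = z)
    (h : partialNorm (umap σ) (p ^ (k + 1)) x = z ^ p) :
    ∃ u : Kˣ, (umap σ)^[p ^ (k + 1)] u = u ∧
      (umap σ)^[p ^ k] (x * u / umap σ u) = x * u / umap σ u := by
  set s := umap σ with hs
  have ht : ∀ x, umap (σ ^ p ^ k) x = s^[p ^ k] x := umap_pow_apply σ _
  set y := partialNorm s (p ^ k) x / z with hy
  have hzt : umap (σ ^ p ^ k) z = z := by rw [ht, Function.iterate_fixed hz]
  have hyp : partialNorm (umap (σ ^ p ^ k)) p y = 1 := by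
    rw [hy, map_div, ← partialNorm_mul ht, ← pow_succ, h, partialNorm_of_fixed hzt, div_self']
  obtain ⟨u, hu⟩ := exists_map_pow_eq_mul hp horder (y := y) (k := k) (by omega) (by
    rw [show p ^ (n - k) = p * p ^ (n - k - 1) by rw [← pow_succ']; congr 1; omega,
      partialNorm_mul (fun x => umap_pow_apply _ p x), hyp, map_one])
  refine ⟨u, ?_, ?_⟩
  · rw [pow_succ, iterate_mul_of_iterate ht,
      iterate_of_map_eq_mul (s := umap (σ ^ p ^ k)) ((ht u).trans hu), hyp, mul_one]
  · have h1 : partialNorm s (p ^ k) (s u / u) = y := by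
      have e := iterate_of_map_eq_mul (s := s) (α := u) (y := s u / u) (by simp) (p ^ k)
      exact mul_left_cancel (e.symm.trans hu)
    have h2 : partialNorm s (p ^ k) (x * u / s u) = z := by
      rw [show x * u / s u = x / (s u / u) by rw [div_div_eq_mul_div], map_div, h1, hy,
        div_div_cancel]
    have h3 := map_partialNorm_mul s (p ^ k) (x * u / s u)
    rw [h2, hz] at h3
    exact (mul_left_cancel h3).symm

/-- Multiplying by the `p`-th power of a Kummer generator of `K_{k+1}/K_k`, one may assume
that `N_{K_k/F}(x)` is a `p`-th power of an element of `F` as soon as it is one in `K`. -/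
lemma exists_norm_mul_pow_eq_pow (hp : p.Prime) (horder : orderOf σ = p ^ n) {ξ : Kˣ}
    (hξ : IsPrimitiveRoot (ξ : K) p) (hξF : ξ ∈ Funits F) {k : ℕ} (hk : k < n) {x z : Kˣ}
    (hx : (umap σ)^[p ^ k] x = x) (h : partialNorm (umap σ) (p ^ k) x = z ^ p) :
    ∃ ε z' : Kˣ, (umap σ)^[p ^ k] (x * ε ^ p) = x * ε ^ p ∧ umap σ z' = z' ∧
      partialNorm (umap σ) (p ^ k) (x * ε ^ p) = z' ^ p := by
  set s := umap σ with hs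
  set ζ := s z / z with hζ
  have hζp : ζ ^ p = 1 := by
    rw [hζ, div_pow, ← map_pow, ← h, map_partialNorm hx, div_self']
  have hζi : s ζ⁻¹ = ζ⁻¹ := umap_root_of_unity hp hξ hξF (by rw [inv_pow, hζp, inv_one])
  obtain ⟨ε, hε⟩ := exists_map_pow_eq_mul hp horder (y := ζ⁻¹) hk.le (by
    rw [partialNorm_of_fixed (by rw [umap_pow_apply, Function.iterate_fixed hζi]),
      show p ^ (n - k) = p * p ^ (n - k - 1) by rw [← pow_succ']; congr 1; omega,
      pow_mul, inv_pow, hζp, inv_one, one_pow])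
  refine ⟨ε, z * partialNorm s (p ^ k) ε, ?_, ?_, ?_⟩
  · rw [iterate_map_mul, hx, iterate_map_pow, hε, mul_pow, inv_pow, hζp, inv_one, mul_one]
  · have h1 := map_partialNorm_mul s (p ^ k) ε
    rw [hε, mul_left_comm, mul_comm ε, mul_left_inj] at h1
    rw [map_mul, h1, show s z = z * ζ by simp [hζ]]
    simp [mul_comm, mul_left_comm]
  · rw [map_mul, map_pow, h, mul_pow]

section Galois

variable [IsGalois F K] [FiniteDimensional F K]

lemma mem_Funits_of_umap_eq (hgen : ∀ τ : K ≃ₐ[F] K, τ ∈ Subgroup.zpowers σ) {x : Kˣ}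
    (hx : umap σ x = x) : x ∈ Funits F := by
  have hall : (x : K) ∈ Set.range (algebraMap F K) := by
    rw [IsGalois.mem_range_algebraMap_iff_fixed]
    intro τ
    obtain ⟨k, rfl⟩ := mem_powers_iff_mem_zpowers.2 (hgen τ)
    have : umap (σ ^ k) x = x := by
      rw [umap_pow_apply, Function.iterate_fixed hx]
    exact congrArg Units.val this
  obtain ⟨y, hy⟩ := hall
  have hy0 : y ≠ 0 := by
    rintro rfl
    exact x.ne_zero (by rw [← hy, map_zero])
  exact ⟨Units.mk0 y hy0, Units.ext hy⟩

/-- Norms from `K` of elements of a proper intermediate field are `p`-th powers in `F`. -/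
lemma partialNorm_mem_FpPow (hgen : ∀ τ : K ≃ₐ[F] K, τ ∈ Subgroup.zpowers σ) {k : ℕ}
    (hk : k < n) {u : Kˣ} (hu : (umap σ)^[p ^ k] u = u) :
    partialNorm (umap σ) (p ^ n) u ∈ FpPow F p := by
  obtain ⟨c, rfl⟩ := Nat.exists_eq_add_of_lt hk
  rw [show p ^ (k + c + 1) = p ^ k * (p ^ c * p) by ring, partialNorm_mul_of_iterate_fixed hu,
    pow_mul]
  exact ⟨_, Subgroup.pow_mem _ (mem_Funits_of_umap_eq hgen (map_partialNorm hu)) _, rfl⟩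

/-- Whether the norm of `α` is a `p`-th power in `F` is detected by a `p`-th root of unity. -/
lemma norm_mem_FpPow_iff (hp : p.Prime)
    (hgen : ∀ τ : K ≃ₐ[F] K, τ ∈ Subgroup.zpowers σ)
    {ξ : Kˣ} (hξ : IsPrimitiveRoot (ξ : K) p) (hξF : ξ ∈ Funits F)
    {M : ℕ} {α x w : Kˣ} (h : umap σ α = α * (x * w ^ p))
    (hx : ∃ P : Kˣ, partialNormProd (umap σ) (M * p) x = P ^ p ∧
      x ^ M * umap σ P = P * partialNorm (umap σ) M x) :
    partialNorm (umap σ) (M * p) α ∈ FpPow F p ↔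
      partialNorm (umap σ) M x * partialNorm (umap σ) (M * p) w = 1 := by
  obtain ⟨E, hE, hE'⟩ := exists_norm_eq_pow h hx
  rw [hE]
  constructor
  · rintro ⟨f, hf, hfE⟩
    have hfE : f ^ p = E ^ p := hfE
    have h1 : umap σ (E / f) = E / f :=
      umap_root_of_unity hp hξ hξF (by rw [div_pow, hfE, div_self'])
    rw [map_div, umap_eq_of_mem_Funits hf, div_left_inj, hE'] at h1
    exact mul_eq_left.1 h1
  · intro h1
    rw [h1, mul_one] at hE'
    exact ⟨E, mem_Funits_of_umap_eq hgen hE', rfl⟩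

/-- If `(σ-1)[γ]` lies in `[K_k^×]` but does not generate a free module over `F_p[G_k]`,
then the level `k` is not minimal. -/
lemma exists_lt_iKFCond (hp : p.Prime) (horder : orderOf σ = p ^ n)
    (hgen : ∀ τ : K ≃ₐ[F] K, τ ∈ Subgroup.zpowers σ) {ξ : Kˣ}
    (hξ : IsPrimitiveRoot (ξ : K) p) (hξF : ξ ∈ Funits F) {k : ℕ} (hk : k < n) {γ x w z : Kˣ}
    (hγ : partialNorm (umap σ) (p ^ n) γ ∉ FpPow F p)
    (hx : (umap σ)^[p ^ k] x = x) (h : umap σ γ = γ * (x * w ^ p))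
    (hz : partialNorm (umap σ) (p ^ k) x = z ^ p) :
    ∃ j : WithBot ℕ, j < (k : WithBot ℕ) ∧ iKFCond p n σ j := by
  cases k with
  | zero =>
    refine ⟨⊥, WithBot.bot_lt_coe 0, (iKFCond_iff hgen).2 ⟨bot_le, γ, 1, z * w, hγ, ?_, ?_⟩⟩
    · exact mem_levelSub_bot.2 rfl
    · have hxz : x = z ^ p := by simpa [partialNorm_apply] using hz
      rw [h, one_mul, mul_pow, hxz]
  | succ k =>
    obtain ⟨ε, z', hε, hz', hN⟩ := exists_norm_mul_pow_eq_pow hp horder hξ hξF hk hx hz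
    obtain ⟨u, hu, hu'⟩ := exists_mul_div_mem_of_norm_eq_pow hp horder (Nat.lt_of_succ_lt hk) hz' hN
    refine ⟨(k : WithBot ℕ), WithBot.coe_lt_coe.2 k.lt_succ_self, (iKFCond_iff hgen).2
      ⟨WithBot.coe_le_coe.2 (Nat.lt_of_succ_lt hk).le, γ / u, x * ε ^ p * u / umap σ u, w / ε, ?_, ?_, ?_⟩⟩
    · rw [map_div]
      intro hcon
      exact hγ (by simpa using Subgroup.mul_mem _ hcon (partialNorm_mem_FpPow hgen hk hu))
    · exact mem_levelSub_coe.2 hu'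
    · rw [map_div, h, div_pow, div_mul_div_comm, div_mul_div_comm, div_eq_div_iff_mul_eq_mul]
      simp only [mul_comm, mul_assoc, mul_left_comm]

end Galois

lemma jcls_eq_one_iff {x : Kˣ} : jcls p x = 1 ↔ ∃ w : Kˣ, x = w ^ p := by
  rw [jcls, QuotientGroup.eq_one_iff]
  exact ⟨fun ⟨w, hw⟩ => ⟨w, hw.symm⟩, fun ⟨w, hw⟩ => ⟨w, hw.symm⟩⟩

lemma jcls_mul_pow (x w : Kˣ) : jcls p (x * w ^ p) = jcls p x :=
  QuotientGroup.mk_mul_of_mem x (MonoidHom.mem_range.2 ⟨w, rfl⟩)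

/-- `FreeCyc` holds unless the norm of the generator is a `p`-th power. -/
lemma freeCyc_of_norm_ne_pow (hp : p.Prime) {k : ℕ} {x : Kˣ}
    (hx : (umap σ)^[p ^ k] x = x) (w : Kˣ)
    (hN : ∀ z : Kˣ, partialNorm (umap σ) (p ^ k) x ≠ z ^ p) :
    FreeCyc p σ k (x * w ^ p) := by
  have hred (τ : K ≃ₐ[F] K) : jcls p (umap τ (x * w ^ p)) = jcls p (umap τ x) := by
    rw [map_mul, map_pow, jcls_mul_pow]
  refine ⟨?_, fun c hc => ?_⟩
  · rw [hred, umap_pow_apply, hx, jcls_mul_pow]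
  by_contra hc0
  have : Fact p.Prime := ⟨hp⟩
  have hit (l : ℕ) : (jmap p σ)^[l] (jcls p x) = jcls p ((umap σ)^[l] x) := by
    induction l with
    | zero => rfl
    | succ l ih => rw [Function.iterate_succ_apply', ih, Function.iterate_succ_apply']; rfl
  have key : partialNorm (jmap p σ) (p ^ k) (jcls p x) = 1 := by
    refine partialNorm_eq_one_of_prod_pow_eq_one (fun a => ?_) (jmap p σ) rfl (jcls p x)
      (by rw [hit, hx]) c hc0 ?_
    · obtain ⟨y, rfl⟩ := QuotientGroup.mk_surjective (s := powSub K p) a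
      exact jcls_eq_one_iff (p := p).2 ⟨y, rfl⟩
    · rw [← hc]
      exact Finset.prod_congr rfl fun l _ => by rw [hit, hred, umap_pow_apply]
  have hprod : jcls p (partialNorm (umap σ) (p ^ k) x) = 1 := by
    rw [← key, partialNorm_apply, partialNorm_apply]
    simp only [hit]
    exact map_prod (QuotientGroup.mk' (powSub K p)) _ _
  obtain ⟨z, hz⟩ := jcls_eq_one_iff.1 hprod
  exact hN z hz

/-- `(α, x, w)` witnesses that the level `j` is the first entry of a norm pair of twist `1`. -/
def IsNormLevel (p n : ℕ) (σ : K ≃ₐ[F] K) (ξ : Kˣ) (j : WithBot ℕ) (α x w : Kˣ) : Prop :=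
  x ∈ levelSub p σ j ∧ umap σ α = α * (x * w ^ p) ∧
    ξ = partialNorm (umap σ) (p ^ (n - 1)) x * partialNorm (umap σ) (p ^ n) w

lemma Represents.isNormLevel {ξ : Kˣ} {m : ℕ} (hm : 0 < m) {a : Fin m → WithBot ℕ} {d : ℤ}
    (hd : (p : ℤ) ∣ d - 1) {α : Kˣ} {δ : ℕ → Kˣ} (h : Represents p n σ ξ a d α δ) :
    ∃ w : Kˣ, IsNormLevel p n σ ξ (a ⟨0, hm⟩) α (δ 0) w := by
  obtain ⟨h1, h2, h3⟩ := h
  refine ⟨α ^ ((d - 1) / (p : ℤ)) * ∏ i ∈ Finset.range m, δ (i + 1) ^ p ^ i,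
    levelMem_iff.1 (h1 ⟨0, hm⟩), ?_, ?_⟩
  · have e : α ^ d = α * (α ^ ((d - 1) / (p : ℤ))) ^ p := by
      rw [← zpow_natCast, ← zpow_mul, Int.ediv_mul_cancel hd, ← zpow_one_add, add_sub_cancel]
    rw [h2, Finset.prod_range_succ', mul_pow, ← Finset.prod_pow, e]
    simp only [← pow_mul _ _ p, ← pow_succ, pow_zero, pow_one]
    simp only [mul_comm, mul_assoc, mul_left_comm]
  · have e : Finset.Icc 1 m = Finset.Ico 1 (m + 1) := rfl
    rw [h3, e, Finset.prod_Ico_eq_prod_range]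
    simp only [normHom_eq, map_mul, map_zpow, map_prod, map_pow, Nat.add_sub_cancel, add_comm 1]
    simp only [mul_comm, mul_assoc]

lemma IsNormLevel.isNormPair {ξ : Kˣ} {j : WithBot ℕ} (hj : j < (n : WithBot ℕ)) {α x w : Kˣ}
    (horder : orderOf σ = p ^ n) (h : IsNormLevel p n σ ξ j α x w)
    {m : ℕ} (hm : 0 < m) :
    IsNormPair p n σ ξ (fun i : Fin m => if (i : ℕ) = 0 then j else (n : WithBot ℕ)) 1 := by
  obtain ⟨hx, hα, hξ⟩ := h
  refine ⟨fun i => ?_, fun _ => by simpa using hj, by simp, α,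
    fun i => if i = 0 then x else if i = 1 then w else 1, fun i => ?_, ?_, ?_⟩
  · dsimp only
    split_ifs
    exacts [hj.le, le_rfl]
  · rw [levelMem_iff]
    dsimp only
    split_ifs
    exacts [hx, mem_levelSub_coe.2 (umap_iterate_eq horder _),
      mem_levelSub_coe.2 (umap_iterate_eq horder _)]
  · obtain ⟨m, rfl⟩ := Nat.exists_eq_add_of_lt hm
    simp [Finset.prod_range_succ', hα, mul_comm]
  · rw [Finset.prod_eq_single_of_mem 1 (Finset.mem_Icc.2 ⟨le_rfl, hm⟩) fun i hi hi1 => by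
      simp [hi1, (Nat.lt_of_succ_le (Finset.mem_Icc.1 hi).1).ne']]
    simpa [normHom_eq] using hξ

lemma IsMinimalNormPair.le {ξ : Kˣ} {m : ℕ} (hm : 0 < m) {a : Fin m → WithBot ℕ} {d : ℤ}
    (horder : orderOf σ = p ^ n) (h : IsMinimalNormPair p n σ ξ a d) {j : WithBot ℕ}
    (hj : j < (n : WithBot ℕ)) {α x w : Kˣ} (hα : IsNormLevel p n σ ξ j α x w) :
    a ⟨0, hm⟩ ≤ j := by
  rcases h.2 _ _ (hα.isNormPair hj horder hm) with ⟨k, hk, hlt⟩ | ⟨rfl, -⟩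
  · by_cases hk0 : k = ⟨0, hm⟩
    · subst hk0
      simpa using hlt.le
    · have := hk ⟨0, hm⟩ (Fin.lt_def.2 (Nat.pos_of_ne_zero fun h0 => hk0 (Fin.ext h0)))
      simpa using this.le
  · simp

lemma exists_partialNormProd_eq_pow_of_mem {j : WithBot ℕ} (hj : j < (n : WithBot ℕ))
    (h : Even (p ^ (n - 1) * (p - 1)) ∨ j = ⊥) {x : Kˣ} (hx : x ∈ levelSub p σ j) :
    ∃ P : Kˣ, partialNormProd (umap σ) (p ^ (n - 1) * p) x = P ^ p ∧
      x ^ p ^ (n - 1) * umap σ P = P * partialNorm (umap σ) (p ^ (n - 1)) x := by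
  rcases h with h | rfl
  · refine exists_partialNormProd_eq_pow h (iterate_eq_of_mem_levelSub hx ?_)
    induction j using WithBot.recBotCoe with
    | bot => exact bot_le
    | coe i => exact WithBot.coe_le_coe.2 (Nat.le_sub_one_of_lt (WithBot.coe_lt_coe.1 hj))
  · obtain rfl := mem_levelSub_bot.1 hx
    exact ⟨1, by simp⟩

lemma even_prime_pow_mul (hp : p.Prime) (hn : 0 < n) (h : ¬(p = 2 ∧ n = 1)) :
    Even (p ^ (n - 1) * (p - 1)) := by
  rcases hp.eq_two_or_odd' with rfl | hodd
  · exact ((Nat.even_pow.2 ⟨even_two, by omega⟩)).mul_right _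
  · exact (Nat.Odd.sub_odd hodd odd_one).mul_left _

section Galois

variable [IsGalois F K] [FiniteDimensional F K]

lemma IsNormLevel.norm_notMem (hp : p.Prime) (hn : 0 < n)
    (hgen : ∀ τ : K ≃ₐ[F] K, τ ∈ Subgroup.zpowers σ) {ξ : Kˣ}
    (hξ : IsPrimitiveRoot (ξ : K) p) (hξF : ξ ∈ Funits F) {j : WithBot ℕ}
    (hj : j < (n : WithBot ℕ)) (he : Even (p ^ (n - 1) * (p - 1)) ∨ j = ⊥) {α x w : Kˣ}
    (h : IsNormLevel p n σ ξ j α x w) : partialNorm (umap σ) (p ^ n) α ∉ FpPow F p := by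
  obtain ⟨hx, hα, hN⟩ := h
  have hpn : p ^ n = p ^ (n - 1) * p := (pow_sub_one_mul hn.ne' p).symm
  rw [hpn] at hN ⊢
  rw [norm_mem_FpPow_iff hp hgen hξ hξF hα (exists_partialNormProd_eq_pow_of_mem hj he hx), ← hN]
  rintro rfl
  exact hξ.ne_one hp.one_lt Units.val_one

/-- Rescaling an element whose norm is not a `p`-th power in `F` yields a norm pair. -/
lemma exists_isNormLevel (hp : p.Prime) (hn : 0 < n) (horder : orderOf σ = p ^ n)
    (hgen : ∀ τ : K ≃ₐ[F] K, τ ∈ Subgroup.zpowers σ) {ξ : Kˣ}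
    (hξ : IsPrimitiveRoot (ξ : K) p) (hξF : ξ ∈ Funits F) {j : WithBot ℕ}
    (hj : j < (n : WithBot ℕ)) (he : Even (p ^ (n - 1) * (p - 1)))
    (h : iKFCond p n σ j) : ∃ α x w : Kˣ, IsNormLevel p n σ ξ j α x w := by
  obtain ⟨-, γ, x, w, hγ, hx, hα⟩ := (iKFCond_iff hgen).1 h
  have hpn : p ^ n = p ^ (n - 1) * p := (pow_sub_one_mul hn.ne' p).symm
  have hP := exists_partialNormProd_eq_pow_of_mem hj (.inl he) hx
  obtain ⟨c, hc⟩ : ∃ c, c = partialNorm (umap σ) (p ^ (n - 1)) x *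
    partialNorm (umap σ) (p ^ n) w := ⟨_, rfl⟩
  have hc1 : c ≠ 1 := by
    rw [hc, hpn]
    intro h1
    rw [hpn] at hγ
    exact hγ ((norm_mem_FpPow_iff hp hgen hξ hξF hα hP).2 h1)
  have hxM : (umap σ)^[p ^ (n - 1)] x = x := by
    apply iterate_eq_of_mem_levelSub hx
    induction j using WithBot.recBotCoe with
    | bot => exact bot_le
    | coe i => exact WithBot.coe_le_coe.2 (Nat.le_sub_one_of_lt (WithBot.coe_lt_coe.1 hj))
  have hcp : c ^ p = 1 := by
    have e := iterate_of_map_eq_mul hα (p ^ n)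
    rw [umap_iterate_eq horder, eq_comm, mul_eq_left, map_mul, map_pow] at e
    rw [hc, mul_pow, ← e]
    congr 1
    rw [hpn, partialNorm_mul_of_iterate_fixed hxM]
  have : Fact p.Prime := ⟨hp⟩
  have hcprim : IsPrimitiveRoot c p := orderOf_eq_prime hcp hc1 ▸ IsPrimitiveRoot.orderOf c
  obtain ⟨i, -, hi⟩ := (IsPrimitiveRoot.coe_units_iff.2 hcprim).eq_pow_of_pow_eq_one hξ.pow_eq_one
  refine ⟨γ ^ i, x ^ i, w ^ i, Subgroup.pow_mem _ hx i, ?_, ?_⟩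
  · rw [map_pow, hα, mul_pow, mul_pow, ← pow_mul, ← pow_mul, mul_comm p]
  · rw [map_pow, map_pow, ← mul_pow, ← hc]
    exact Units.ext (by rw [← hi, Units.val_pow_eq_pow_val])

end Galois

/-- If `ξ` is a norm from `K`, then `-∞` is the first entry of a norm pair. -/
lemma exists_isNormLevel_bot (horder : orderOf σ = p ^ n) (hpos : 0 < p ^ n) {ξ γ : Kˣ}
    (hξ : ξ ^ p = 1) (hγ : normHom p σ n γ = ξ) :
    ∃ α : Kˣ, IsNormLevel p n σ ξ ⊥ α 1 γ := by
  rw [normHom_eq] at hγ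
  obtain ⟨α, hα⟩ := exists_map_eq_mul_of_partialNorm_eq_one σ (y := γ ^ p) (horder ▸ hpos)
    (by rw [map_pow, horder, hγ, hξ])
  exact ⟨α, mem_levelSub_bot.2 rfl, by rw [hα, one_mul], by rw [map_one, one_mul, hγ]⟩

end GaloisAction

end MSS

/-- **Proposition.**  Let `α ∈ K^×` be `1`-exceptional.  Then (1) `α` is
MSS-exceptional; (2) for any minimal norm pair `((a_0,…,a_{m-1}), d)` of any
length `m ≥ 1`, `a_0 = i(K/F)`; (3) if `i(K/F) ≠ -∞` then the cyclic
`F_p[G]`-submodule of `J_1` generated by `(σ-1)[α]_1` is a free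
`F_p[G_{i(K/F)}]`-module. -/
theorem statement_10 {F : Type u} {K : Type v} [Field F] [Field K] [Algebra F K]
    [IsGalois F K] [FiniteDimensional F K]
    (p n : ℕ) (hp : p.Prime) (hn : 0 < n)
    (σ : K ≃ₐ[F] K) (horder : orderOf σ = p ^ n)
    (hgen : ∀ τ : K ≃ₐ[F] K, τ ∈ Subgroup.zpowers σ)
    (ξ : Kˣ) (hξ : IsPrimitiveRoot (ξ : K) p)
    (hξF : (ξ : K) ∈ Set.range (algebraMap F K))
    (hspecial : p = 2 → n = 1 → ∃ γ : Kˣ, MSS.normHom p σ n γ = -1)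
    (α : Kˣ) (hexc : MSS.IsExceptional p n σ ξ 1 α) :
    MSS.IsMSSExceptional p n σ α ∧
    (∀ (m : ℕ) (hm : 0 < m) (a : Fin m → WithBot ℕ) (d : ℤ),
      MSS.IsMinimalNormPair p n σ ξ a d → a ⟨0, hm⟩ = MSS.iKF F p n σ) ∧
    (∀ k : ℕ, MSS.iKF F p n σ = (k : WithBot ℕ) →
      MSS.FreeCyc p σ k (MSS.umap σ α * α⁻¹)) := by
  have hξF' : ξ ∈ MSS.Funits F := by
    obtain ⟨y, hy⟩ := hξF
    have hy0 : y ≠ 0 := by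
      rintro rfl
      exact ξ.ne_zero (by rw [← hy, map_zero])
    exact ⟨Units.mk0 y hy0, Units.ext hy⟩
  -- in the degenerate case `[K : F] = 2`, minimal norm pairs start with `-∞`
  have hbot (hpn : p = 2 ∧ n = 1) : ∃ α x w : Kˣ, MSS.IsNormLevel p n σ ξ ⊥ α x w := by
    obtain ⟨γ, hγ⟩ := hspecial hpn.1 hpn.2
    have hξ1 : ξ = -1 := Units.ext <| by
      have h2 := hpn.1 ▸ hξ
      simpa using h2.eq_neg_one_of_two_right
    obtain ⟨α, hα⟩ := MSS.exists_isNormLevel_bot (ξ := ξ) horder (pow_pos hp.pos n)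
      (Units.ext (by simpa using hξ.pow_eq_one)) (hγ.trans hξ1.symm)
    exact ⟨α, _, _, hα⟩
  have hmain (m : ℕ) (hm : 0 < m) (a : Fin m → WithBot ℕ) (d : ℤ)
      (h : MSS.IsMinimalNormPair p n σ ξ a d) : a ⟨0, hm⟩ < (n : WithBot ℕ) ∧
      (Even (p ^ (n - 1) * (p - 1)) ∨ a ⟨0, hm⟩ = ⊥) ∧ a ⟨0, hm⟩ = MSS.iKF F p n σ := by
    obtain ⟨-, han, hd, β, δ, hβ⟩ := h.1
    have han := han hm
    obtain ⟨w, hw⟩ := hβ.isNormLevel hm hd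
    have he : Even (p ^ (n - 1) * (p - 1)) ∨ a ⟨0, hm⟩ = ⊥ := by
      by_cases hpn : p = 2 ∧ n = 1
      · obtain ⟨β', x', w', h'⟩ := hbot hpn
        exact .inr (le_bot_iff.1 (h.le hm horder (WithBot.bot_lt_coe n) h'))
      · exact .inl (MSS.even_prime_pow_mul hp hn hpn)
    refine ⟨han, he, Eq.symm (IsLeast.csInf_eq ⟨?_, fun j hj => ?_⟩)⟩
    · exact (MSS.iKFCond_iff hgen).2 ⟨han.le, β, δ 0, w,
        hw.norm_notMem hp hn hgen hξ hξF' han he, hw.1, hw.2.1⟩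
    · rcases he with he | he
      · rcases hj.1.lt_or_eq with hjn | rfl
        · obtain ⟨β', x', w', h'⟩ :=
            MSS.exists_isNormLevel hp hn horder hgen hξ hξF' hjn he hj
          exact h.le hm horder hjn h'
        · exact han.le
      · exact he.le.trans bot_le
  obtain ⟨a, d, δ, hmin, hα⟩ := hexc
  obtain ⟨han, he, ha⟩ := hmain 1 one_pos a d hmin
  obtain ⟨w, hw⟩ := hα.isNormLevel one_pos hmin.1.2.2.1
  have hN := hw.norm_notMem hp hn hgen hξ hξF' han he
  rw [ha] at han
  refine ⟨⟨by rwa [MSS.normHom_eq], ?_⟩, fun m hm a d h => (hmain m hm a d h).2.2,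
    fun k hk => ?_⟩
  · rw [← ha]
    exact MSS.jcls_mem_of_map_eq hgen hw.1 hw.2.1
  · rw [hw.2.1, mul_inv_cancel_comm]
    have hx := hw.1
    rw [ha, hk] at hx
    rw [hk] at han
    have hx := MSS.mem_levelSub_coe.1 hx
    refine MSS.freeCyc_of_norm_ne_pow hp hx w fun z hz => ?_
    obtain ⟨j, hjk, hj⟩ := MSS.exists_lt_iKFCond hp horder hgen hξ hξF'
      (WithBot.coe_lt_coe.1 han) hN hx hw.2.1 hz
    exact (hjk.trans_le (hk.symm.le.trans (csInf_le (OrderBot.bddBelow _) hj))).false
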